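/- Let Λ = {Λ_ω ∈ B(H,E) : ω ∈ Ω} and Θ = {Θ_ω ∈ B(H,E) : ω ∈ Ω} be strongly disjoint continuous g-frames for H with respect to E, and let α, β ∈ ℂ with |α|² + |β|² > 0. Then αΛ + βΘ = {αΛ_ω + βΘ_ω : ω ∈ Ω} is a continuous g-frame for H with respect to E. -/

import Mathlib

open MeasureTheory
open scoped ENNReal NNReal Pointwise

noncomputable section

local notation "⟪" x ", " y "⟫" => @inner ℂ _ _ x y

variable {Ω : Type*} [MeasurableSpace Ω]

section Defs

variable {F G E : Type*}
  [NormedAddCommGroup F] [InnerProductSpace ℂ F]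
  [NormedAddCommGroup G] [InnerProductSpace ℂ G]
  [NormedAddCommGroup E] [InnerProductSpace ℂ E]

/-- `Λ` is a continuous g-frame for `F` with respect to `E`, with frame bounds `A`, `B`:
for every `f`, `ω ↦ Λ ω f` is strongly measurable and
`A‖f‖² ≤ ∫ ‖Λ ω f‖² dμ(ω) ≤ B‖f‖²`. -/
def IsCgFrame (μ : Measure Ω) (Λ : Ω → F →L[ℂ] E) (A B : ℝ) : Prop :=
  (∀ f : F, StronglyMeasurable fun ω => Λ ω f) ∧
    ∀ f : F,
      ENNReal.ofReal (A * ‖f‖ ^ 2) ≤ ∫⁻ ω, (‖Λ ω f‖₊ : ℝ≥0∞) ^ 2 ∂μ ∧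
        ∫⁻ ω, (‖Λ ω f‖₊ : ℝ≥0∞) ^ 2 ∂μ ≤ ENNReal.ofReal (B * ‖f‖ ^ 2)

/-- `Λ` is a continuous g-Bessel family with Bessel constant `B`. -/
def IsCgBessel (μ : Measure Ω) (Λ : Ω → F →L[ℂ] E) (B : ℝ) : Prop :=
  (∀ f : F, StronglyMeasurable fun ω => Λ ω f) ∧
    ∀ f : F, ∫⁻ ω, (‖Λ ω f‖₊ : ℝ≥0∞) ^ 2 ∂μ ≤ ENNReal.ofReal (B * ‖f‖ ^ 2)

/-- `Λ` is a tight continuous g-frame with bound `A`. -/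
def IsCgTight (μ : Measure Ω) (Λ : Ω → F →L[ℂ] E) (A : ℝ) : Prop :=
  (∀ f : F, StronglyMeasurable fun ω => Λ ω f) ∧
    ∀ f : F, ∫⁻ ω, (‖Λ ω f‖₊ : ℝ≥0∞) ^ 2 ∂μ = ENNReal.ofReal (A * ‖f‖ ^ 2)

/-- `Λ` is a Parseval continuous g-frame. -/
def IsCgParseval (μ : Measure Ω) (Λ : Ω → F →L[ℂ] E) : Prop :=
  (∀ f : F, StronglyMeasurable fun ω => Λ ω f) ∧
    ∀ f : F, ∫⁻ ω, (‖Λ ω f‖₊ : ℝ≥0∞) ^ 2 ∂μ = ENNReal.ofReal (‖f‖ ^ 2)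

/-- The range of the analysis operator `T*_Λ : F → Ê = L²(Ω,μ;E)`, i.e. the set of elements of
`L²(Ω,μ;E)` represented by `ω ↦ Λ ω f` for some `f : F`. -/
def analysisRange (μ : Measure Ω) (Λ : Ω → F →L[ℂ] E) : Set (Lp E 2 μ) :=
  {φ | ∃ f : F, (fun ω => Λ ω f) =ᵐ[μ] (φ : Ω → E)}

/-- `Λ` and `Θ` are strongly disjoint: the ranges of their analysis operators are orthogonal,
equivalently `∫ ⟨Λ ω h, Θ ω k⟩ dμ(ω) = 0` for all `h`, `k`. -/
def StronglyDisjoint (μ : Measure Ω) (Λ : Ω → F →L[ℂ] E) (Θ : Ω → G →L[ℂ] E) : Prop :=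
  ∀ (h : F) (k : G), ∫ ω, ⟪Λ ω h, Θ ω k⟫ ∂μ = 0

/-- `Λ` and `Θ` are disjoint: `Range T*_Λ ∩ Range T*_Θ = {0}` and
`Range T*_Λ + Range T*_Θ` is closed in `Ê`. -/
def IsDisjoint (μ : Measure Ω) (Λ : Ω → F →L[ℂ] E) (Θ : Ω → G →L[ℂ] E) : Prop :=
  analysisRange μ Λ ∩ analysisRange μ Θ = {(0 : Lp E 2 μ)} ∧
    IsClosed (analysisRange μ Λ + analysisRange μ Θ)

/-- `Λ` and `Θ` are weakly disjoint: `Range T*_Λ ∩ Range T*_Θ = {0}`. -/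
def WeaklyDisjoint (μ : Measure Ω) (Λ : Ω → F →L[ℂ] E) (Θ : Ω → G →L[ℂ] E) : Prop :=
  analysisRange μ Λ ∩ analysisRange μ Θ = {(0 : Lp E 2 μ)}

/-- `Λ` and `Θ` are a complementary pair: `Range T*_Λ ∩ Range T*_Θ = {0}` and
`Range T*_Λ + Range T*_Θ = Ê`. -/
def ComplementaryPair (μ : Measure Ω) (Λ : Ω → F →L[ℂ] E) (Θ : Ω → G →L[ℂ] E) : Prop :=
  analysisRange μ Λ ∩ analysisRange μ Θ = {(0 : Lp E 2 μ)} ∧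
    analysisRange μ Λ + analysisRange μ Θ = (Set.univ : Set (Lp E 2 μ))

/-- `Λ` and `Θ` are a strongly complementary pair: `Ê` is the orthogonal direct sum of
`Range T*_Λ` and `Range T*_Θ`. -/
def StronglyComplementaryPair (μ : Measure Ω) (Λ : Ω → F →L[ℂ] E) (Θ : Ω → G →L[ℂ] E) : Prop :=
  StronglyDisjoint μ Λ Θ ∧
    analysisRange μ Λ + analysisRange μ Θ = (Set.univ : Set (Lp E 2 μ))

/-- `S` is the (continuous g-)frame operator of `Λ`:
`⟨S f, g⟩ = ∫ ⟨Λ ω f, Λ ω g⟩ dμ(ω)`. -/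
def IsFrameOperator (μ : Measure Ω) (Λ : Ω → F →L[ℂ] E) (S : F →L[ℂ] F) : Prop :=
  ∀ f g : F, ⟪S f, g⟫ = ∫ ω, ⟪Λ ω f, Λ ω g⟫ ∂μ

/-- `Θ` is a dual of `Λ`: `∫ ⟨Θ ω f, Λ ω g⟩ dμ(ω) = ⟨f, g⟩` for all `f`, `g`. -/
def IsDualOf (μ : Measure Ω) (Θ Λ : Ω → F →L[ℂ] E) : Prop :=
  ∀ f g : F, ∫ ω, ⟪Θ ω f, Λ ω g⟫ ∂μ = ⟪f, g⟫

/-- `Λ` is a Riesz-type continuous g-frame: it is a continuous g-frame and every dual of `Λ`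
is weakly equal to the canonical dual `{Λ_ω S_Λ⁻¹}`, where `S_Λ` is the frame operator. -/
def IsRieszType (μ : Measure Ω) (Λ : Ω → F →L[ℂ] E) : Prop :=
  (∃ A B : ℝ, 0 < A ∧ IsCgFrame μ Λ A B) ∧
    ∀ S : F ≃L[ℂ] F, IsFrameOperator μ Λ (S : F →L[ℂ] F) →
      ∀ Θ : Ω → F →L[ℂ] E, (∃ A B : ℝ, 0 < A ∧ IsCgFrame μ Θ A B) → IsDualOf μ Θ Λ →
        ∀ f : F, ∀ᵐ ω ∂μ, Θ ω f = Λ ω (S.symm f)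

/-- The operator `h ⊕ k ↦ Λω h + Θω k` on the Hilbert direct sum `F ⊕ G = WithLp 2 (F × G)`. -/
def pairMap (Λω : F →L[ℂ] E) (Θω : G →L[ℂ] E) : WithLp 2 (F × G) →L[ℂ] E :=
  (Λω.comp (ContinuousLinearMap.fst ℂ F G) + Θω.comp (ContinuousLinearMap.snd ℂ F G)).comp
    (WithLp.prodContinuousLinearEquiv 2 ℂ F G).toContinuousLinearMap

end Defs

theorem memLp_two_of_lintegral_sq_ne_top {E : Type*} [NormedAddCommGroup E] {μ : Measure Ω}
    {u : Ω → E} (hu : AEStronglyMeasurable u μ)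
    (h : ∫⁻ ω, (‖u ω‖₊ : ℝ≥0∞) ^ 2 ∂μ ≠ ∞) : MemLp u 2 μ := by
  refine ⟨hu, ?_⟩
  rw [eLpNorm_lt_top_iff_lintegral_rpow_enorm_lt_top two_ne_zero ENNReal.ofNat_ne_top]
  simpa [enorm_eq_nnnorm] using h.lt_top

theorem lintegral_nnnorm_sq_eq_ofReal_integral {E : Type*} [NormedAddCommGroup E]
    {μ : Measure Ω} {u : Ω → E} (hu : MemLp u 2 μ) :
    ∫⁻ ω, (‖u ω‖₊ : ℝ≥0∞) ^ 2 ∂μ = ENNReal.ofReal (∫ ω, ‖u ω‖ ^ 2 ∂μ) := by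
  rw [ofReal_integral_eq_lintegral_ofReal ((memLp_two_iff_integrable_sq_norm hu.1).1 hu)
    (Filter.Eventually.of_forall fun ω => sq_nonneg _)]
  refine lintegral_congr fun ω => ?_
  rw [ENNReal.ofReal_pow (norm_nonneg _), ofReal_norm, enorm_eq_nnnorm]

theorem integrable_inner_of_memLp_two {E : Type*} [NormedAddCommGroup E]
    [InnerProductSpace ℂ E] {μ : Measure Ω} {u v : Ω → E} (hu : MemLp u 2 μ) (hv : MemLp v 2 μ) :
    Integrable (fun ω => ⟪u ω, v ω⟫) μ := by
  refine (((memLp_two_iff_integrable_sq_norm hu.1).1 hu).add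
    ((memLp_two_iff_integrable_sq_norm hv.1).1 hv)).mono' (hu.1.inner hv.1)
    (Filter.Eventually.of_forall fun ω => (norm_inner_le_norm _ _).trans ?_)
  simp only [Pi.add_apply]
  nlinarith [sq_nonneg (‖u ω‖ - ‖v ω‖), sq_nonneg ‖u ω‖, sq_nonneg ‖v ω‖]

/-- Pythagoras' identity for orthogonal square-integrable functions. -/
theorem integral_norm_sq_smul_add_smul {E : Type*} [NormedAddCommGroup E]
    [InnerProductSpace ℂ E] {μ : Measure Ω} {u v : Ω → E} (hu : MemLp u 2 μ) (hv : MemLp v 2 μ)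
    (huv : ∫ ω, ⟪u ω, v ω⟫ ∂μ = 0) (α β : ℂ) :
    ∫ ω, ‖α • u ω + β • v ω‖ ^ 2 ∂μ =
      ‖α‖ ^ 2 * ∫ ω, ‖u ω‖ ^ 2 ∂μ + ‖β‖ ^ 2 * ∫ ω, ‖v ω‖ ^ 2 ∂μ := by
  have hi : Integrable (fun ω => ⟪α • u ω, β • v ω⟫) μ :=
    integrable_inner_of_memLp_two (hu.const_smul α) (hv.const_smul β)
  have hz : ∫ ω, RCLike.re ⟪α • u ω, β • v ω⟫ ∂μ = 0 := by
    rw [integral_re hi]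
    simp_rw [inner_smul_left, inner_smul_right]
    rw [integral_const_mul, integral_const_mul, huv]
    simp
  have hu2 := (memLp_two_iff_integrable_sq_norm hu.1).1 hu
  have hv2 := (memLp_two_iff_integrable_sq_norm hv.1).1 hv
  have hsum : Integrable
      (fun ω => ‖α‖ ^ 2 * ‖u ω‖ ^ 2 + 2 * RCLike.re ⟪α • u ω, β • v ω⟫) μ :=
    (hu2.const_mul _).add (hi.re.const_mul _)
  calc ∫ ω, ‖α • u ω + β • v ω‖ ^ 2 ∂μ
      = ∫ ω, (‖α‖ ^ 2 * ‖u ω‖ ^ 2 + 2 * RCLike.re ⟪α • u ω, β • v ω⟫)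
          + ‖β‖ ^ 2 * ‖v ω‖ ^ 2 ∂μ := by
        refine integral_congr_ae (Filter.Eventually.of_forall fun ω => ?_)
        simp only [@norm_add_sq ℂ, norm_smul, mul_pow]
    _ = _ := by
        rw [integral_add hsum (hv2.const_mul _),
          integral_add (hu2.const_mul _) (hi.re.const_mul _), integral_const_mul,
          integral_const_mul, integral_const_mul, hz, mul_zero, add_zero]

theorem lintegral_nnnorm_sq_smul_add_smul {E : Type*} [NormedAddCommGroup E]
    [InnerProductSpace ℂ E] {μ : Measure Ω} {u v : Ω → E} (hu : MemLp u 2 μ) (hv : MemLp v 2 μ)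
    (huv : ∫ ω, ⟪u ω, v ω⟫ ∂μ = 0) (α β : ℂ) :
    ∫⁻ ω, (‖α • u ω + β • v ω‖₊ : ℝ≥0∞) ^ 2 ∂μ =
      ENNReal.ofReal (‖α‖ ^ 2) * ∫⁻ ω, (‖u ω‖₊ : ℝ≥0∞) ^ 2 ∂μ +
        ENNReal.ofReal (‖β‖ ^ 2) * ∫⁻ ω, (‖v ω‖₊ : ℝ≥0∞) ^ 2 ∂μ := by
  have hu0 : 0 ≤ ∫ ω, ‖u ω‖ ^ 2 ∂μ := integral_nonneg fun ω => sq_nonneg _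
  have hv0 : 0 ≤ ∫ ω, ‖v ω‖ ^ 2 ∂μ := integral_nonneg fun ω => sq_nonneg _
  have hw : MemLp (fun ω => α • u ω + β • v ω) 2 μ := (hu.const_smul α).add (hv.const_smul β)
  rw [lintegral_nnnorm_sq_eq_ofReal_integral hw, integral_norm_sq_smul_add_smul hu hv huv,
    lintegral_nnnorm_sq_eq_ofReal_integral hu, lintegral_nnnorm_sq_eq_ofReal_integral hv,
    ENNReal.ofReal_add (by positivity) (by positivity), ENNReal.ofReal_mul (sq_nonneg _),
    ENNReal.ofReal_mul (sq_nonneg _)]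

theorem IsCgFrame.memLp {F E : Type*} [NormedAddCommGroup F] [InnerProductSpace ℂ F]
    [NormedAddCommGroup E] [InnerProductSpace ℂ E] {μ : Measure Ω} {Λ : Ω → F →L[ℂ] E}
    {A B : ℝ} (h : IsCgFrame μ Λ A B) (f : F) : MemLp (fun ω => Λ ω f) 2 μ :=
  memLp_two_of_lintegral_sq_ne_top (h.1 f).aestronglyMeasurable
    ((h.2 f).2.trans_lt ENNReal.ofReal_lt_top).ne

variable {H K E : Type*}
  [NormedAddCommGroup H] [InnerProductSpace ℂ H] [CompleteSpace H]
  [NormedAddCommGroup K] [InnerProductSpace ℂ K] [CompleteSpace K]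
  [NormedAddCommGroup E] [InnerProductSpace ℂ E] [CompleteSpace E]

/-- if `Λ`, `Θ` are strongly disjoint continuous g-frames and
`|α|² + |β|² > 0`, then `{αΛ_ω + βΘ_ω}` is a continuous g-frame. -/
theorem stmt8 (μ : Measure Ω) (Λ Θ : Ω → H →L[ℂ] E)
    (AL BL AT BT : ℝ) (hAL : 0 < AL) (hAT : 0 < AT)
    (hL : IsCgFrame μ Λ AL BL) (hT : IsCgFrame μ Θ AT BT)
    (hdis : StronglyDisjoint μ Λ Θ) (α β : ℂ) (hab : 0 < ‖α‖ ^ 2 + ‖β‖ ^ 2) :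
    ∃ A B : ℝ, 0 < A ∧ IsCgFrame μ (fun ω => α • Λ ω + β • Θ ω) A B := by
  have hA : 0 < ‖α‖ ^ 2 * AL + ‖β‖ ^ 2 * AT := by
    have hα : 0 ≤ ‖α‖ ^ 2 := sq_nonneg _
    have hβ : 0 ≤ ‖β‖ ^ 2 := sq_nonneg _
    rcases hα.eq_or_lt with h | h
    · rw [← h, zero_add] at hab
      rw [← h, zero_mul, zero_add]
      exact mul_pos hab hAT
    · exact add_pos_of_pos_of_nonneg (mul_pos h hAL) (mul_nonneg hβ hAT.le)
  refine ⟨‖α‖ ^ 2 * AL + ‖β‖ ^ 2 * AT, ‖α‖ ^ 2 * max BL 0 + ‖β‖ ^ 2 * max BT 0, hA,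
    fun f => ((hL.1 f).const_smul α).add ((hT.1 f).const_smul β), fun f => ?_⟩
  have hsplit : ∀ a b : ℝ, 0 ≤ a → 0 ≤ b →
      ENNReal.ofReal ((‖α‖ ^ 2 * a + ‖β‖ ^ 2 * b) * ‖f‖ ^ 2) =
        ENNReal.ofReal (‖α‖ ^ 2) * ENNReal.ofReal (a * ‖f‖ ^ 2) +
          ENNReal.ofReal (‖β‖ ^ 2) * ENNReal.ofReal (b * ‖f‖ ^ 2) := by
    intro a b ha hb
    rw [← ENNReal.ofReal_mul (sq_nonneg _), ← ENNReal.ofReal_mul (sq_nonneg _),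
      ← ENNReal.ofReal_add (by positivity) (by positivity)]
    congr 1
    ring
  have key := lintegral_nnnorm_sq_smul_add_smul (hL.memLp f) (hT.memLp f) (hdis f f) α β
  simp only [add_apply, smul_apply]
  rw [key, hsplit _ _ hAL.le hAT.le, hsplit _ _ (le_max_right _ _) (le_max_right _ _)]
  have hBL := (hL.2 f).2.trans (ENNReal.ofReal_le_ofReal
    (mul_le_mul_of_nonneg_right (le_max_left BL 0) (sq_nonneg ‖f‖)))
  have hBT := (hT.2 f).2.trans (ENNReal.ofReal_le_ofReal
    (mul_le_mul_of_nonneg_right (le_max_left BT 0) (sq_nonneg ‖f‖)))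
  exact ⟨add_le_add (mul_le_mul_right (hL.2 f).1 _) (mul_le_mul_right (hT.2 f).1 _),
    add_le_add (mul_le_mul_right hBL _) (mul_le_mul_right hBT _)⟩
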